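/- The second integral group homology of the symmetric group on 4 letters is cyclic of order 2: H₂(S₄; ℤ) ≅ ℤ/2ℤ. -/

import Mathlib

/-- The differential of the (inhomogeneous) bar complex computing the group homology
`H_*(G; ℤ)` with trivial coefficients: on the free `ℤ`-module on `Gⁿ⁺¹`,
`d(g₁,…,g_{n+1}) = (g₂,…,g_{n+1}) + ∑_{i=1}^{n} (−1)^i (g₁,…,g_i g_{i+1},…,g_{n+1})
+ (−1)^{n+1} (g₁,…,g_n)`. -/
noncomputable def barDelta (G : Type*) [Group G] (n : ℕ) :
    ((Fin (n + 1) → G) →₀ ℤ) →ₗ[ℤ] ((Fin n → G) →₀ ℤ) :=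
  ∑ j : Fin (n + 2),
    (-1 : ℤ) ^ (j : ℕ) • Finsupp.lmapDomain ℤ ℤ
      (fun (g : Fin (n + 1) → G) (i : Fin n) =>
        if (i : ℕ) + 1 < (j : ℕ) then g i.castSucc
        else if (i : ℕ) + 1 = (j : ℕ) then g i.castSucc * g i.succ
        else g i.succ)

/-- The second group homology `H₂(G; ℤ)` of `G` with coefficients in the trivial
`G`-module `ℤ`, computed as the homology of the bar complex in degree 2. -/
noncomputable abbrev barH2 (G : Type*) [Group G] :=
  ↥(LinearMap.ker (barDelta G 1)) ⧸
    (LinearMap.range (barDelta G 2)).comap (LinearMap.ker (barDelta G 1)).subtype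

open Equiv

section Bar

variable {G : Type*} [Group G]

theorem barDelta_one_single (g h : G) :
    barDelta G 1 (Finsupp.single ![g, h] 1) =
      Finsupp.single ![h] 1 - Finsupp.single ![g * h] 1 + Finsupp.single ![g] 1 := by
  rw [barDelta, LinearMap.sum_apply]
  refine (Fin.sum_univ_three _).trans ?_
  simp only [LinearMap.smul_apply, Finsupp.lmapDomain_apply, Finsupp.mapDomain_single]
  rw [show ∀ a b c : (Fin 1 → G) →₀ ℤ, a - b + c =
    (-1 : ℤ) ^ ((0 : Fin 3) : ℕ) • a + (-1 : ℤ) ^ ((1 : Fin 3) : ℕ) • b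
      + (-1 : ℤ) ^ ((2 : Fin 3) : ℕ) • c from
    fun a b c => by simp [sub_eq_add_neg]]
  congr <;> (ext i; fin_cases i; simp)

theorem barDelta_two_single (g h k : G) :
    barDelta G 2 (Finsupp.single ![g, h, k] 1) =
      Finsupp.single ![h, k] 1 - Finsupp.single ![g * h, k] 1
        + Finsupp.single ![g, h * k] 1 - Finsupp.single ![g, h] 1 := by
  rw [barDelta, LinearMap.sum_apply]
  refine (Fin.sum_univ_four _).trans ?_
  simp only [LinearMap.smul_apply, Finsupp.lmapDomain_apply, Finsupp.mapDomain_single]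
  rw [show ∀ a b c d : (Fin 2 → G) →₀ ℤ, a - b + c - d =
    (-1 : ℤ) ^ ((0 : Fin 4) : ℕ) • a + (-1 : ℤ) ^ ((1 : Fin 4) : ℕ) • b
      + (-1 : ℤ) ^ ((2 : Fin 4) : ℕ) • c + (-1 : ℤ) ^ ((3 : Fin 4) : ℕ) • d from
    fun a b c d => by simp [pow_succ, sub_eq_add_neg]]
  congr <;> (ext i; fin_cases i <;> simp)

/-- A homomorphism on 2-chains vanishes on boundaries iff it is a 2-cocycle. -/
theorem comp_barDelta_two_eq_zero_iff {M : Type*} [AddCommGroup M]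
    (χ : ((Fin 2 → G) →₀ ℤ) →ₗ[ℤ] M) :
    χ ∘ₗ barDelta G 2 = 0 ↔ ∀ g h k,
      χ (.single ![h, k] 1) + χ (.single ![g, h * k] 1) =
        χ (.single ![g * h, k] 1) + χ (.single ![g, h] 1) := by
  constructor
  · intro hχ g h k
    have := LinearMap.congr_fun hχ (.single ![g, h, k] 1)
    simp only [LinearMap.comp_apply, barDelta_two_single, map_add, map_sub,
      LinearMap.zero_apply] at this
    rw [← sub_eq_zero, ← this]
    abel
  · intro hc
    refine Finsupp.lhom_ext' fun v => LinearMap.ext_ring ?_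
    obtain ⟨g, h, k, rfl⟩ : ∃ g h k, v = ![g, h, k] :=
      ⟨v 0, v 1, v 2, by ext i; fin_cases i <;> rfl⟩
    simp only [LinearMap.comp_apply, Finsupp.lsingle_apply, LinearMap.zero_apply,
      barDelta_two_single, map_add, map_sub]
    rw [← sub_eq_zero.2 (hc g h k)]
    abel

/-- A 2-cocycle which is a coboundary vanishes on 2-cycles. -/
theorem apply_eq_zero_of_coboundary {M : Type*} [AddCommGroup M]
    (χ : ((Fin 2 → G) →₀ ℤ) →ₗ[ℤ] M) (φ : G → M)
    (hφ : ∀ g h, χ (.single ![g, h] 1) = φ h - φ (g * h) + φ g)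
    {v : (Fin 2 → G) →₀ ℤ} (hv : barDelta G 1 v = 0) : χ v = 0 := by
  have key : χ = Finsupp.lift M ℤ (Fin 1 → G) (fun t => φ (t 0)) ∘ₗ barDelta G 1 := by
    refine Finsupp.lhom_ext' fun v => LinearMap.ext_ring ?_
    obtain ⟨g, h, rfl⟩ : ∃ g h, v = ![g, h] := ⟨v 0, v 1, by ext i; fin_cases i <;> rfl⟩
    simp only [LinearMap.comp_apply, Finsupp.lsingle_apply, barDelta_one_single, hφ, map_add,
      map_sub]
    simp
  rw [key, LinearMap.comp_apply, hv, map_zero]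

/-- A 2-cocycle is the factor set of a central extension. -/
theorem exists_centralExtension.{u, v} {M : Type u} [AddCommGroup M] {G : Type v} [Group G]
    (f : G → G → M)
    (hf : ∀ g h k, f h k + f g (h * k) = f (g * h) k + f g h) :
    ∃ (E : Type (max u v)) (_ : Group E) (π : E →* G) (ι : Multiplicative M →* E) (s : G → E),
      (∀ g, π (s g) = g) ∧ π.ker = ι.range ∧ π.ker ≤ Subgroup.center E ∧
      Function.Injective ι ∧
      ∀ g h, s g * s h = ι (.ofAdd (f g h)) * s (g * h) := by
  have f1l : ∀ k, f 1 k = f 1 1 := fun k => by simpa using hf 1 1 k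
  have f1r : ∀ g, f g 1 = f 1 1 := fun g => by simpa using (hf g 1 1).symm
  let _ : Mul (M × G) := ⟨fun x y => (x.1 + y.1 + f x.2 y.2, x.2 * y.2)⟩
  let _ : One (M × G) := ⟨(-f 1 1, 1)⟩
  let _ : Inv (M × G) := ⟨fun x => (-x.1 - f 1 1 - f x.2⁻¹ x.2, x.2⁻¹)⟩
  have hmul : ∀ x y : M × G, x * y = (x.1 + y.1 + f x.2 y.2, x.2 * y.2) := fun _ _ => rfl
  have hone : (1 : M × G) = (-f 1 1, 1) := rfl
  have hinv : ∀ x : M × G, x⁻¹ = (-x.1 - f 1 1 - f x.2⁻¹ x.2, x.2⁻¹) := fun _ => rfl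
  let _ : Group (M × G) := Group.ofLeftAxioms
    (fun x y z => by
      simp only [hmul, Prod.mk.injEq, mul_assoc, and_true]
      have := hf x.2 y.2 z.2
      rw [show x.1 + (y.1 + z.1 + f y.2 z.2) + f x.2 (y.2 * z.2) =
        x.1 + y.1 + z.1 + (f y.2 z.2 + f x.2 (y.2 * z.2)) by abel, this]
      abel)
    (fun x => by
      simp [hmul, hone, f1l])
    (fun x => by
      simp [hmul, hone, hinv]
      abel)
  refine ⟨M × G, inferInstance, ⟨⟨Prod.snd, rfl⟩, fun _ _ => rfl⟩,
    ⟨⟨fun m => (m.toAdd - f 1 1, 1), ?_⟩, fun m n => ?_⟩, fun g => (0, g), fun _ => rfl,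
    ?_, ?_, ?_, fun g h => ?_⟩
  · simp [hone]
  · simp [hmul]
    abel
  · ext ⟨m, g⟩
    constructor
    · intro h
      obtain rfl : g = 1 := h
      exact ⟨.ofAdd (m + f 1 1), by simp⟩
    · rintro ⟨n, h⟩
      exact (congrArg Prod.snd h).symm
  · rintro ⟨m, g⟩ h
    obtain rfl : g = 1 := h
    rw [Subgroup.mem_center_iff]
    rintro ⟨n, k⟩
    simp [hmul, f1l, f1r, add_comm]
  · intro m n h
    have := congrArg Prod.fst h
    simpa using this
  · simp [hmul, f1l]

open scoped IsMulCommutative in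
/-- If commuting elements have non-commuting lifts in a central extension, the corresponding
2-cycle is not a boundary. -/
theorem commutator_cycle_notMem_range {E : Type*} [Group E] (π : E →* G)
    (hπ : Function.Surjective π) (hker : π.ker ≤ Subgroup.center E) {x y : E}
    (hcomm : π x * π y = π y * π x) (hxy : x * y ≠ y * x) :
    (Finsupp.single ![π x, π y] 1 - Finsupp.single ![π y, π x] 1 : (Fin 2 → G) →₀ ℤ) ∉
      LinearMap.range (barDelta G 2) := by
  obtain ⟨s, hs⟩ := hπ.hasRightInverse
  have hcent : ∀ {e e' : E}, π e = π e' → ∃ z : Subgroup.center E, e = z * e' := by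
    intro e e' h
    exact ⟨⟨e * e'⁻¹, hker (by simp [MonoidHom.mem_ker, h])⟩, by simp⟩
  choose F hF using fun g h => hcent (e := s g * s h) (e' := s (g * h)) (by simp [hs _])
  let χ : ((Fin 2 → G) →₀ ℤ) →ₗ[ℤ] Additive (Subgroup.center E) :=
    Finsupp.lift _ ℤ (Fin 2 → G) fun t => .ofMul (F (t 0) (t 1))
  have hχs : ∀ g h, χ (.single ![g, h] 1) = .ofMul (F g h) := fun g h => by simp [χ]
  have hz : ∀ (z : Subgroup.center E) (e : E), e * z = z * e := fun z e =>
    Subgroup.mem_center_iff.1 z.2 e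
  have hχ : χ ∘ₗ barDelta G 2 = 0 := by
    rw [comp_barDelta_two_eq_zero_iff]
    intro g h k
    simp only [hχs, ← ofMul_mul]
    congr 1
    apply Subtype.ext
    push_cast
    have h1 : s g * s h * s k = F (g * h) k * F g h * s (g * h * k) := by
      rw [hF, mul_assoc, hF, ← mul_assoc, ← hz (F g h)]
    have h2 : s g * s h * s k = F h k * F g (h * k) * s (g * h * k) := by
      rw [mul_assoc, hF h k, ← mul_assoc, hz, mul_assoc, hF, mul_assoc, mul_assoc g]
    exact mul_right_cancel (h2.symm.trans h1)
  rintro ⟨u, hu⟩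
  have h0 := LinearMap.congr_fun hχ u
  rw [LinearMap.comp_apply, hu, map_sub, hχs, hχs, LinearMap.zero_apply, sub_eq_zero] at h0
  have h0 : F (π x) (π y) = F (π y) (π x) := h0
  have hss : s (π x) * s (π y) = s (π y) * s (π x) := by
    rw [hF, hF, h0, hcomm]
  obtain ⟨p, hp⟩ := hcent (e := x) (e' := s (π x)) (hs _).symm
  obtain ⟨q, hq⟩ := hcent (e := y) (e' := s (π y)) (hs _).symm
  apply hxy
  rw [hp, hq]
  exact Commute.mul_left (hz p _).symm (Commute.mul_right (hz q _) hss)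

end Bar

section CentralExtension

theorem closure_adjacent_swaps_four :
    Subgroup.closure {swap 0 1, swap 1 2, swap 2 3} = (⊤ : Subgroup (Perm (Fin 4))) := by
  have h := Equiv.Perm.mclosure_swap_castSucc_succ 3
  rw [eq_top_iff, ← Subgroup.toSubmonoid_le, Subgroup.top_toSubmonoid, ← h,
    Submonoid.closure_le]
  rintro _ ⟨i, rfl⟩
  apply Subgroup.subset_closure
  fin_cases i <;> simp

variable {E : Type*} [Group E]

/-- The normal form words in the Coxeter generators of the symmetric group on four letters. -/
def coxeterWord (a b c : E) (i : Fin 2) (j : Fin 3) (k : Fin 4) : E :=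
  ![1, a] i * ![1, b, b * a] j * ![1, c, c * b, c * b * a] k

theorem exists_coxeterWord_eq {a b c : E} (ha : a * a = 1) (hb : b * b = 1) (hc : c * c = 1)
    (hab : a * b * a = b * a * b) (hbc : b * c * b = c * b * c) (hac : a * c = c * a)
    {x : E} (hx : x ∈ Subgroup.closure {a, b, c}) : ∃ i j k, x = coxeterWord a b c i j k := by
  have step₂ : ∀ i : Fin 2, ∃ i', ![1, a] i * a = ![1, a] i' := by
    intro i
    fin_cases i
    exacts [⟨1, by simp⟩, ⟨0, by simp [ha]⟩]
  have step₃ : ∀ (i : Fin 2) (j : Fin 3), ∀ x ∈ ({1, a, b} : Set E), ∃ i' j',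
      ![1, a] i * ![1, b, b * a] j * x = ![1, a] i' * ![1, b, b * a] j' := by
    intro i j x hx
    suffices h : ∃ y ∈ ({1, a} : Set E), ∃ j', ![1, b, b * a] j * x = y * ![1, b, b * a] j' by
      obtain ⟨y, hy, j', h⟩ := h
      obtain ⟨i', hi'⟩ : ∃ i', ![1, a] i * y = ![1, a] i' := by
        rcases hy with rfl | rfl
        exacts [⟨i, mul_one _⟩, step₂ i]
      exact ⟨i', j', by rw [mul_assoc, h, ← mul_assoc, hi']⟩
    rcases hx with rfl | rfl | rfl
    · exact ⟨1, by simp, j, by simp⟩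
    · fin_cases j
      exacts [⟨x, by simp, 0, by simp⟩, ⟨1, by simp, 2, by simp⟩,
        ⟨1, by simp, 1, by simp [mul_assoc, ha]⟩]
    · fin_cases j
      exacts [⟨1, by simp, 1, by simp⟩, ⟨1, by simp, 0, by simp [hb]⟩,
        ⟨a, by simp, 2, by simp [← mul_assoc, hab]⟩]
  have step₄ : ∀ i j k, ∀ x ∈ ({a, b, c} : Set E), ∃ i' j' k',
      coxeterWord a b c i j k * x = coxeterWord a b c i' j' k' := by
    intro i j k x hx
    suffices h : ∃ y ∈ ({1, a, b} : Set E), ∃ k',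
        ![1, c, c * b, c * b * a] k * x = y * ![1, c, c * b, c * b * a] k' by
      obtain ⟨y, hy, k', h⟩ := h
      obtain ⟨i', j', hij⟩ := step₃ i j y hy
      exact ⟨i', j', k', by rw [coxeterWord, coxeterWord, mul_assoc, h, ← mul_assoc, hij]⟩
    rcases hx with rfl | rfl | rfl
    · fin_cases k
      exacts [⟨x, by simp, 0, by simp⟩, ⟨x, by simp, 1, by simp [hac]⟩, ⟨1, by simp, 3, by simp⟩,
        ⟨1, by simp, 2, by simp [mul_assoc, ha]⟩]
    · fin_cases k
      exacts [⟨x, by simp, 0, by simp⟩, ⟨1, by simp, 2, by simp⟩,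
        ⟨1, by simp, 1, by simp [mul_assoc, hb]⟩,
        ⟨a, by simp, 3, by
          have : c * (x * a * x) = a * c * x * a := by rw [← hab, hac]; group
          simpa [mul_assoc] using this⟩]
    · fin_cases k
      exacts [⟨1, by simp, 1, by simp⟩, ⟨1, by simp, 0, by simp [hc]⟩,
        ⟨b, by simp, 2, by simp [← hbc, mul_assoc]⟩,
        ⟨b, by simp, 3, by
          have : x * b * (a * x) = b * x * b * a := by rw [hac, hbc]; group
          simpa [mul_assoc] using this⟩]
  have inv_mem : ∀ x ∈ ({a, b, c} : Set E), x⁻¹ = x := by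
    rintro x (rfl | rfl | rfl) <;> rw [inv_eq_iff_mul_eq_one] <;> assumption
  induction hx using Subgroup.closure_induction_right with
  | one => exact ⟨0, 0, 0, by simp [coxeterWord]⟩
  | mul_right x _ y hy ih =>
    obtain ⟨i, j, k, rfl⟩ := ih
    exact step₄ i j k y hy
  | mul_inv_cancel x _ y hy ih =>
    obtain ⟨i, j, k, rfl⟩ := ih
    rw [inv_mem y hy]
    exact step₄ i j k y hy

theorem coxeterWord_swap_ne_one : ∀ i j k,
    coxeterWord (swap 0 1 : Perm (Fin 4)) (swap 1 2) (swap 2 3) i j k = 1 →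
      i = 0 ∧ j = 0 ∧ k = 0 := by
  decide

theorem map_coxeterWord {G : Type*} [Group G] (π : E →* G) (a b c : E) (i j k) :
    π (coxeterWord a b c i j k) = coxeterWord (π a) (π b) (π c) i j k := by
  fin_cases i <;> fin_cases j <;> fin_cases k <;> simp [coxeterWord]

/-- A lift of the Coxeter generators satisfying the Coxeter relations gives a section. -/
theorem exists_section_of_coxeter (π : E →* Perm (Fin 4)) {a b c : E}
    (hπa : π a = swap 0 1) (hπb : π b = swap 1 2) (hπc : π c = swap 2 3)
    (ha : a * a = 1) (hb : b * b = 1) (hc : c * c = 1)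
    (hab : a * b * a = b * a * b) (hbc : b * c * b = c * b * c) (hac : a * c = c * a) :
    ∃ σ : Perm (Fin 4) →* E, ∀ g, π (σ g) = g := by
  let H := Subgroup.closure ({a, b, c} : Set E)
  have hbij : Function.Bijective (π.comp H.subtype) := by
    constructor
    · rw [injective_iff_map_eq_one]
      rintro ⟨x, hx⟩ h
      obtain ⟨i, j, k, rfl⟩ := exists_coxeterWord_eq ha hb hc hab hbc hac hx
      have h' : π (coxeterWord a b c i j k) = 1 := h
      rw [map_coxeterWord, hπa, hπb, hπc] at h'
      obtain ⟨rfl, rfl, rfl⟩ := coxeterWord_swap_ne_one i j k h'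
      simp [coxeterWord]
    · rw [← MonoidHom.range_eq_top, MonoidHom.range_comp, Subgroup.range_subtype,
        MonoidHom.map_closure, ← closure_adjacent_swaps_four]
      simp [Set.image_insert_eq, hπa, hπb, hπc]
  let e := MulEquiv.ofBijective _ hbij
  exact ⟨H.subtype.comp e.symm.toMonoidHom, fun g => e.apply_symm_apply g⟩

theorem exists_central_braid {G : Type*} [Group G] (π : E →* G)
    (hker : π.ker ≤ Subgroup.center E) {a b : E} (ha : a * a = 1) (hb : b * b = 1)
    (hab : π (a * b * a) = π (b * a * b)) :
    ∃ z ∈ π.ker, (a * z) * (a * z) = 1 ∧ (a * z) * b * (a * z) = b * (a * z) * b := by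
  have ha' : a⁻¹ = a := inv_eq_of_mul_eq_one_left ha
  have hb' : b⁻¹ = b := inv_eq_of_mul_eq_one_left hb
  set z := b * a * b * (a * b * a)⁻¹ with hz
  have hzk : z ∈ π.ker := by rw [MonoidHom.mem_ker, hz, map_mul, map_inv, hab, mul_inv_cancel]
  have hzc : ∀ e, e * z = z * e := Subgroup.mem_center_iff.1 (hker hzk)
  have hz1 : b * a * b = z * (a * b * a) := by rw [hz]; group
  have hzz : z * z = 1 := by
    have h1 : z⁻¹ = a * z * a⁻¹ := by
      rw [hz]
      simp [ha', hb', mul_assoc, ha]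
    rw [hzc, mul_inv_cancel_right] at h1
    exact inv_eq_iff_mul_eq_one.1 h1
  refine ⟨z, hzk, ?_, ?_⟩
  · rw [(show Commute z a from (hzc a).symm).mul_mul_mul_comm, ha, hzz, one_mul]
  · calc a * z * b * (a * z) = a * b * a * (z * z) := by
          simp only [mul_assoc, ← hzc (b * (a * z))]
      _ = b * a * b * z := by rw [hz1, hzz, mul_one, ← hzc, mul_assoc _ z z, hzz, mul_one]
      _ = b * (a * z) * b := by simp only [mul_assoc, hzc b]

/-- A central extension of the symmetric group on four letters by a 2-divisible group splits as
soon as two disjoint transpositions have commuting lifts. -/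
theorem exists_section_of_commute (π : E →* Perm (Fin 4)) (hπ : Function.Surjective π)
    (hker : π.ker ≤ Subgroup.center E) (hdiv : ∀ z ∈ π.ker, ∃ y ∈ π.ker, y * y = z)
    {x y : E} (hx : π x = swap 0 1) (hy : π y = swap 2 3) (hxy : x * y = y * x) :
    ∃ σ : Perm (Fin 4) →* E, ∀ g, π (σ g) = g := by
  have hinvol : ∀ x : E, π x * π x = 1 → ∃ z ∈ π.ker, (x * z) * (x * z) = 1 := by
    intro x hx
    obtain ⟨u, hu, hux⟩ := hdiv (x * x) (by rw [MonoidHom.mem_ker, map_mul, hx])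
    have huc : ∀ e, e * u = u * e := Subgroup.mem_center_iff.1 (hker hu)
    refine ⟨u⁻¹, inv_mem hu, ?_⟩
    have : Commute x u⁻¹ := (show Commute x u from huc x).inv_right
    rw [this.symm.mul_mul_mul_comm, ← hux]
    group
  have hcomm : ∀ {z w : E}, z ∈ π.ker → w ∈ π.ker → ∀ {x y : E}, Commute x y →
      Commute (x * z) (y * w) := by
    intro z w hz hw x y h
    have hz := fun e => (show Commute e z from Subgroup.mem_center_iff.1 (hker hz) e)
    have hw := fun e => (show Commute e w from Subgroup.mem_center_iff.1 (hker hw) e)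
    exact (h.mul_left (hz y).symm).mul_right (hw _)
  obtain ⟨b', hb'⟩ := hπ (swap 1 2)
  obtain ⟨u, hu, hu'⟩ := hinvol x (by rw [hx, swap_mul_self])
  obtain ⟨v, hv, hv'⟩ := hinvol b' (by rw [hb', swap_mul_self])
  obtain ⟨w, hw, hw'⟩ := hinvol y (by rw [hy, swap_mul_self])
  have hxu : π (x * u) = swap 0 1 := by rw [map_mul, hu, mul_one, hx]
  have hbv : π (b' * v) = swap 1 2 := by rw [map_mul, hv, mul_one, hb']
  have hyw : π (y * w) = swap 2 3 := by rw [map_mul, hw, mul_one, hy]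
  obtain ⟨p, hp, hp1, hp2⟩ := exists_central_braid π hker hu' hv' (by
    simp only [map_mul π (_ * _), hxu, hbv]
    decide)
  obtain ⟨q, hq, hq1, hq2⟩ := exists_central_braid π hker hw' hv' (by
    simp only [map_mul π (_ * _), hyw, hbv]
    decide)
  exact exists_section_of_coxeter π (by rw [map_mul, hp, mul_one, hxu]) hbv
    (by rw [map_mul, hq, mul_one, hyw]) hp1 hv' hq1 hp2 hq2.symm
    (hcomm hp hq (hcomm hu hw hxy))

end CentralExtension

section Upper

/-- The 2-cycle attached to the commuting transpositions `(0 1)` and `(2 3)`. -/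
noncomputable def swapCycle : (Fin 2 → Perm (Fin 4)) →₀ ℤ :=
  Finsupp.single ![swap 0 1, swap 2 3] 1 - Finsupp.single ![swap 2 3, swap 0 1] 1

theorem swap_zero_one_mul_swap_two_three :
    (swap 0 1 * swap 2 3 : Perm (Fin 4)) = swap 2 3 * swap 0 1 := by decide

theorem barDelta_swapCycle : barDelta _ 1 swapCycle = 0 := by
  rw [swapCycle, map_sub, barDelta_one_single, barDelta_one_single,
    swap_zero_one_mul_swap_two_three]
  abel

theorem apply_two_smul_swapCycle {M : Type*} [AddCommGroup M]
    (χ : ((Fin 2 → Perm (Fin 4)) →₀ ℤ) →ₗ[ℤ] M) (hχ : χ ∘ₗ barDelta _ 2 = 0) :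
    χ ((2 : ℤ) • swapCycle) = 0 := by
  obtain ⟨E, _, π, ι, s, hs, hk, hc, hι, hsm⟩ :=
    exists_centralExtension _ ((comp_barDelta_two_eq_zero_iff χ).1 hχ)
  set a := s (swap 0 1)
  set c := s (swap 2 3)
  set m := χ swapCycle with hm
  have hcent : ∀ {z}, z ∈ π.ker → ∀ e, e * z = z * e := fun hz =>
    Subgroup.mem_center_iff.1 (hc hz)
  have hιk : ∀ n, ι n ∈ π.ker := fun n => hk ▸ ⟨n, rfl⟩
  have h1 : a * c = ι (.ofAdd m) * (c * a) := by
    rw [hsm, hsm, ← mul_assoc, ← map_mul, ← ofAdd_add, hm, swapCycle, map_sub, sub_add_cancel,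
      swap_zero_one_mul_swap_two_three]
  have haa : a * a ∈ π.ker := by rw [MonoidHom.mem_ker, map_mul, hs, swap_mul_self]
  have h2 : c * (a * a) = ι (.ofAdd m) * ι (.ofAdd m) * (c * (a * a)) := by
    calc c * (a * a) = a * (a * c) := by rw [hcent haa, mul_assoc]
      _ = a * ι (.ofAdd m) * (c * a) := by rw [h1, mul_assoc]
      _ = ι (.ofAdd m) * ((a * c) * a) := by rw [hcent (hιk _)]; group
      _ = _ := by rw [h1]; group
  rw [right_eq_mul, ← map_mul, ← map_one ι] at h2
  have h3 : m + m = 0 := hι h2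
  rw [map_smul, two_smul, h3]

theorem apply_eq_zero_of_swapCycle {M : Type*} [AddCommGroup M] (hdiv : ∀ m : M, ∃ n, n + n = m)
    (χ : ((Fin 2 → Perm (Fin 4)) →₀ ℤ) →ₗ[ℤ] M) (hχ : χ ∘ₗ barDelta _ 2 = 0)
    (hw : χ swapCycle = 0) {v : (Fin 2 → Perm (Fin 4)) →₀ ℤ} (hv : barDelta _ 1 v = 0) :
    χ v = 0 := by
  obtain ⟨E, _, π, ι, s, hs, hk, hc, hι, hsm⟩ :=
    exists_centralExtension _ ((comp_barDelta_two_eq_zero_iff χ).1 hχ)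
  rw [swapCycle, map_sub, sub_eq_zero] at hw
  obtain ⟨σ, hσ⟩ := exists_section_of_commute π (fun g => ⟨s g, hs g⟩) hc (by
      rw [hk]
      rintro _ ⟨m, rfl⟩
      obtain ⟨n, hn⟩ := hdiv m.toAdd
      exact ⟨_, ⟨.ofAdd n, rfl⟩, by rw [← map_mul, ← ofAdd_add, hn, ofAdd_toAdd]⟩)
    (hs _) (hs _) (by rw [hsm, hsm, hw, swap_zero_one_mul_swap_two_three])
  have hex : ∀ g, ∃ m : M, s g = ι (.ofAdd m) * σ g := fun g => by
    have : s g * (σ g)⁻¹ ∈ ι.range := by rw [← hk, MonoidHom.mem_ker]; simp [hs, hσ]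
    obtain ⟨m, hm⟩ := this
    exact ⟨m.toAdd, by rw [ofAdd_toAdd, hm, inv_mul_cancel_right]⟩
  choose φ hφ using hex
  refine apply_eq_zero_of_coboundary χ φ (fun g h => ?_) hv
  have h1 := hsm g h
  have hcent : ∀ n e, e * ι n = ι n * e := fun n =>
    Subgroup.mem_center_iff.1 (hc (hk ▸ ⟨n, rfl⟩))
  have h2 : s g * s h = ι (.ofAdd (φ g + φ h)) * σ (g * h) := by
    rw [hφ g, hφ h, ofAdd_add, map_mul, map_mul, mul_assoc, ← mul_assoc (σ g), hcent]
    simp only [mul_assoc]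
  rw [h2, hφ (g * h), ← mul_assoc, ← map_mul] at h1
  have h3 : φ g + φ h = _ + φ (g * h) := hι (mul_right_cancel h1)
  rw [eq_comm, ← sub_eq_iff_eq_add] at h3
  rw [← h3]
  abel

theorem mem_of_forall_character {A : Type*} [AddCommGroup A] (N : Submodule ℤ A) {v : A}
    (h : ∀ χ : A →ₗ[ℤ] AddCircle (1 : ℚ), N ≤ LinearMap.ker χ → χ v = 0) : v ∈ N := by
  rw [← Submodule.Quotient.mk_eq_zero]
  refine CharacterModule.eq_zero_of_character_apply fun c => ?_
  refine h (AddMonoidHom.toIntLinearMap c ∘ₗ N.mkQ) fun x hx => ?_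
  have : N.mkQ x = 0 := by simpa using hx
  simp only [LinearMap.mem_ker, LinearMap.comp_apply, this, map_zero]

theorem two_smul_swapCycle_mem : (2 : ℤ) • swapCycle ∈ LinearMap.range (barDelta _ 2) :=
  mem_of_forall_character _ fun χ hχ =>
    apply_two_smul_swapCycle χ (LinearMap.range_le_ker_iff.1 hχ)

theorem mem_range_sup_span_swapCycle {v : (Fin 2 → Perm (Fin 4)) →₀ ℤ}
    (hv : barDelta _ 1 v = 0) :
    v ∈ LinearMap.range (barDelta _ 2) ⊔ Submodule.span ℤ {swapCycle} :=
  mem_of_forall_character _ fun χ hχ => apply_eq_zero_of_swapCycle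
    (fun m => ⟨DivisibleBy.div m (2 : ℤ), by
      rw [← two_zsmul, DivisibleBy.div_cancel m two_ne_zero]⟩) χ
    (LinearMap.range_le_ker_iff.1 (le_sup_left.trans hχ))
    (hχ (Submodule.mem_sup_right (Submodule.mem_span_singleton_self _))) hv

end Upper

section Lower

open OnePoint Matrix

instance : DecidableEq (OnePoint (ZMod 3)) := inferInstanceAs (DecidableEq (Option (ZMod 3)))

/-- A labelling of the projective line over the field with three elements. -/
def projectiveLineThree : Fin 4 ≃ OnePoint (ZMod 3) where
  toFun := ![((1 : ZMod 3) : OnePoint (ZMod 3)), (2 : ZMod 3), (0 : ZMod 3), ∞]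
  invFun p := p.elim 3 ![2, 0, 1]
  left_inv := by decide
  right_inv := by
    rintro (_ | x)
    · rfl
    · change Fin 3 at x; fin_cases x <;> rfl

/-- The action of `GL₂(𝔽₃)` on the four points of the projective line. -/
noncomputable def glThreeToPerm : GL (Fin 2) (ZMod 3) →* Perm (Fin 4) :=
  (projectiveLineThree.symm.permCongrHom.toMonoidHom).comp
    (MulAction.toPermHom (GL (Fin 2) (ZMod 3)) (OnePoint (ZMod 3)))

theorem glThreeToPerm_apply (g : GL (Fin 2) (ZMod 3)) (i : Fin 4) :
    glThreeToPerm g i = projectiveLineThree.symm (g • projectiveLineThree i) := rfl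

theorem ker_glThreeToPerm_le : glThreeToPerm.ker ≤ Subgroup.center _ := by
  intro g hg
  have hfix : ∀ p : OnePoint (ZMod 3), g • p = p := by
    intro p
    have := DFunLike.congr_fun (MonoidHom.mem_ker.1 hg) (projectiveLineThree.symm p)
    simpa [glThreeToPerm_apply] using this
  have h10 : g 1 0 = 0 := smul_infty_eq_self_iff.1 (hfix ∞)
  have h0 := hfix (0 : ZMod 3)
  have h1 := hfix (1 : ZMod 3)
  rw [smul_some_eq_ite] at h0 h1
  have h11 : g 1 1 ≠ 0 := by
    intro h
    simp [h10, h] at h0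
  have h01 : g 0 1 = 0 := by simpa [h10, h11] using h0
  have h00 : g 0 0 = g 1 1 := by
    simpa [h10, h11, h01, div_eq_one_iff_eq] using h1
  rw [Subgroup.mem_center_iff]
  intro h
  ext i j
  simp only [Units.val_mul, Matrix.mul_apply, Fin.sum_univ_two]
  fin_cases i <;> fin_cases j <;> simp [h10, h01, h00, mul_comm]

/-- A lift of the transposition `(0 1)`. -/
def glThreeA : GL (Fin 2) (ZMod 3) := ⟨!![1, 0; 0, 2], !![1, 0; 0, 2], by decide, by decide⟩

/-- A lift of the transposition `(1 2)`. -/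
def glThreeB : GL (Fin 2) (ZMod 3) := ⟨!![2, 2; 0, 1], !![2, 2; 0, 1], by decide, by decide⟩

/-- A lift of the transposition `(2 3)`. -/
def glThreeC : GL (Fin 2) (ZMod 3) := ⟨!![0, 1; 1, 0], !![0, 1; 1, 0], by decide, by decide⟩

theorem glThreeToPerm_eq_iff {g : GL (Fin 2) (ZMod 3)} {σ : Perm (Fin 4)} :
    glThreeToPerm g = σ ↔ ∀ i, g • projectiveLineThree i = projectiveLineThree (σ i) := by
  simp only [Equiv.ext_iff, glThreeToPerm_apply, Equiv.symm_apply_eq]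

theorem glThreeToPerm_A : glThreeToPerm glThreeA = swap 0 1 := by
  rw [glThreeToPerm_eq_iff]
  intro i
  fin_cases i
  exacts [smul_some_eq_ite.trans (by decide +kernel), smul_some_eq_ite.trans (by decide +kernel),
    smul_some_eq_ite.trans (by decide +kernel), (smul_infty_eq_ite _).trans (by decide +kernel)]

theorem glThreeToPerm_B : glThreeToPerm glThreeB = swap 1 2 := by
  rw [glThreeToPerm_eq_iff]
  intro i
  fin_cases i
  exacts [smul_some_eq_ite.trans (by decide +kernel), smul_some_eq_ite.trans (by decide +kernel),
    smul_some_eq_ite.trans (by decide +kernel), (smul_infty_eq_ite _).trans (by decide +kernel)]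

theorem glThreeToPerm_C : glThreeToPerm glThreeC = swap 2 3 := by
  rw [glThreeToPerm_eq_iff]
  intro i
  fin_cases i
  exacts [smul_some_eq_ite.trans (by decide +kernel), smul_some_eq_ite.trans (by decide +kernel),
    smul_some_eq_ite.trans (by decide +kernel), (smul_infty_eq_ite _).trans (by decide +kernel)]

theorem swapCycle_notMem : swapCycle ∉ LinearMap.range (barDelta _ 2) := by
  have hsurj : Function.Surjective glThreeToPerm := by
    rw [← MonoidHom.range_eq_top, eq_top_iff, ← closure_adjacent_swaps_four, Subgroup.closure_le]
    rintro _ (rfl | rfl | rfl)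
    exacts [⟨_, glThreeToPerm_A⟩, ⟨_, glThreeToPerm_B⟩, ⟨_, glThreeToPerm_C⟩]
  have := commutator_cycle_notMem_range glThreeToPerm hsurj ker_glThreeToPerm_le
    (x := glThreeA) (y := glThreeC)
    (by rw [glThreeToPerm_A, glThreeToPerm_C, swap_zero_one_mul_swap_two_three])
    (fun h => absurd (congrArg Units.val h) (by decide))
  rwa [glThreeToPerm_A, glThreeToPerm_C] at this

end Lower

/-- `H₂(S₄; ℤ) ≅ ℤ/2ℤ`: the second integral group homology of the symmetric group
on 4 letters is cyclic of order 2. -/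
theorem stmt_14 :
    Nonempty (barH2 (Equiv.Perm (Fin 4)) ≃ₗ[ℤ] ZMod 2) := by
  let w : LinearMap.ker (barDelta (Perm (Fin 4)) 1) := ⟨swapCycle, barDelta_swapCycle⟩
  let q := ((LinearMap.range (barDelta (Perm (Fin 4)) 2)).comap
    (LinearMap.ker (barDelta (Perm (Fin 4)) 1)).subtype).mkQ
  have hq : ∀ x, q x = 0 ↔ (x : (Fin 2 → Perm (Fin 4)) →₀ ℤ) ∈ LinearMap.range (barDelta _ 2) :=
    fun x => by simp [q]
  have hw : q w ≠ 0 := fun h => swapCycle_notMem ((hq w).1 h)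
  have h2w : (2 : ℤ) • q w = 0 := by
    rw [← map_smul, hq]
    exact two_smul_swapCycle_mem
  have hall : ∀ y, y ≠ 0 → y = q w := by
    intro y hy
    obtain ⟨v, rfl⟩ := Submodule.mkQ_surjective _ y
    obtain ⟨n, hn, m, hm, hnm⟩ := Submodule.mem_sup.1 (mem_range_sup_span_swapCycle v.2)
    obtain ⟨k, rfl⟩ := Submodule.mem_span_singleton.1 hm
    have hvk : q v = k • q w := by
      rw [← sub_eq_zero, ← map_smul, ← map_sub, hq]
      simpa [w, ← hnm] using hn
    rcases Int.even_or_odd' k with ⟨l, rfl | rfl⟩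
    · exact absurd (by rw [hvk, mul_comm, mul_smul, h2w, smul_zero]) hy
    · rw [hvk, add_smul, mul_comm, mul_smul, h2w, smul_zero, zero_add, one_smul]
  have hcard : Nat.card (barH2 (Perm (Fin 4))) = 2 :=
    (Nat.card_eq_two_iff' 0).2 ⟨q w, hw, hall⟩
  have : IsAddCyclic (barH2 (Perm (Fin 4))) := isAddCyclic_of_prime_card hcard
  exact ⟨(((ZMod.ringEquivCongr hcard).toAddEquiv.symm.trans
    (zmodAddCyclicAddEquiv this)).symm).toIntLinearEquiv⟩
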